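/- Let A₂ be the level-2 Schreier adjacency matrix of the BSV torsion-free group with d = 4, i.e., the 16×16 integer matrix indexed by words of length 2 over {0,1,2,3} with A₂(u,v) = #{s ∈ {a,a⁻¹,b,b⁻¹} : s(u) = v}. Then, as an identity of polynomials in t over ℤ, det(I₁₆ − t·A₂ + 3t²·I₁₆) = (t−1)(t+1)(3t−1)(3t+1)(3t²+1)²·(9t⁴−2t²+1)²·(9t⁴−6t³+2t²−2t+1)²·(9t⁴+6t³+2t²+2t+1)². (This is the determinant factor in the Ihara–Bass formula for the Ihara zeta function of the level-2 Schreier graph Γ₂ of the BSV group, and it factors as the product of the Artin L-function determinant factors of the ℤ/4ℤ-Galois covering Γ₂|Γ₁.) -/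

import Mathlib

/-- The generator `a` of the BSV torsion-free group with `d = 4`:
`a(xw)=(x+1)·w` for `x < 3` and `a(3w)=0·a(w)`. -/
def bsvA : List (Fin 4) → List (Fin 4)
  | [] => []
  | x :: w => if (x : ℕ) = 3 then (x + 1) :: bsvA w else (x + 1) :: w

/-- The inverse generator `a⁻¹`: `a⁻¹(xw)=(x-1)·w` for `x > 0` and `a⁻¹(0w)=3·a⁻¹(w)`. -/
def bsvAinv : List (Fin 4) → List (Fin 4)
  | [] => []
  | x :: w => if (x : ℕ) = 0 then (x - 1) :: bsvAinv w else (x - 1) :: w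

mutual
/-- The generator `b`: `b(xw)=(x+1)·w` for `x < 3` and `b(3w)=0·b⁻¹(w)`. -/
def bsvB : List (Fin 4) → List (Fin 4)
  | [] => []
  | x :: w => if (x : ℕ) = 3 then (x + 1) :: bsvBinv w else (x + 1) :: w
/-- The inverse generator `b⁻¹`: `b⁻¹(xw)=(x-1)·w` for `x > 0` and `b⁻¹(0w)=3·b(w)`. -/
def bsvBinv : List (Fin 4) → List (Fin 4)
  | [] => []
  | x :: w => if (x : ℕ) = 0 then (x - 1) :: bsvB w else (x - 1) :: w
end

/-- The generating set `{a, a⁻¹, b, b⁻¹}` of the BSV group with `d = 4`. -/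
def bsvGens : List (List (Fin 4) → List (Fin 4)) := [bsvA, bsvAinv, bsvB, bsvBinv]

open Polynomial

/-- The level-2 Schreier adjacency matrix `A₂` of the BSV group with `d = 4`, indexed
by words `uv` of length 2 over `{0,1,2,3}`:
`A₂(u,v) = #{s ∈ {a,a⁻¹,b,b⁻¹} : s(u) = v}`. -/
def bsvAdj2 : Matrix (Fin 4 × Fin 4) (Fin 4 × Fin 4) ℤ :=
  fun u v => (bsvGens.countP (fun s => decide (s [u.1, u.2] = [v.1, v.2])) : ℤ)

open scoped Kronecker

/-- A basis of `ℤ⁴` up to finite index, written as columns, that diagonalises the adjacency matrix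
of the `4`-cycle; the corresponding eigenvalues are `fourCycleEigenvalue`. -/
def fourCycleEigenbasis : Matrix (Fin 4) (Fin 4) ℤ :=
  !![1, 1, 1, 0; 1, -1, 0, 1; 1, 1, -1, 0; 1, -1, 0, -1]

/-- The eigenvalues of the adjacency matrix of the `4`-cycle. -/
def fourCycleEigenvalue : Fin 4 → ℤ := ![2, -2, 0, 0]

/-- The adjacency matrix of the `4`-cycle with three edges of weight `2` and one of weight `l`. -/
def weightedFourCycle (l : ℤ) : Matrix (Fin 4) (Fin 4) ℤ :=
  !![0, 2, 0, l; 2, 0, 2, 0; 0, 2, 0, 2; l, 0, 2, 0]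

theorem det_fourCycleEigenbasis_ne_zero : fourCycleEigenbasis.det ≠ 0 := by
  decide +kernel

theorem bsvAdj2_mul_one_kronecker :
    bsvAdj2 * ((1 : Matrix (Fin 4) (Fin 4) ℤ) ⊗ₖ fourCycleEigenbasis) =
      ((1 : Matrix (Fin 4) (Fin 4) ℤ) ⊗ₖ fourCycleEigenbasis) *
        Matrix.blockDiagonal (fun i => weightedFourCycle (fourCycleEigenvalue i)) := by
  decide +kernel

/-- If an integer matrix `A` is intertwined with `B` by a matrix of nonzero determinant, then
every matrix polynomial `p - q A` has the same determinant as `p - q B`. -/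
theorem det_smul_one_sub_smul_map_eq {n : Type*} [Fintype n] [DecidableEq n]
    {A B K : Matrix n n ℤ} (hK : K.det ≠ 0) (h : A * K = K * B) (p q : ℤ[X]) :
    (p • (1 : Matrix n n ℤ[X]) - q • A.map C).det =
      (p • (1 : Matrix n n ℤ[X]) - q • B.map C).det := by
  have hmap : A.map C * K.map C = K.map C * B.map C := by
    rw [← Matrix.map_mul, h, Matrix.map_mul]
  have hdet : (K.map C).det ≠ 0 := by
    have := RingHom.map_det (C : ℤ →+* ℤ[X]) K
    rw [RingHom.mapMatrix_apply] at this
    rw [← this]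
    exact C_ne_zero.mpr hK
  refine mul_right_cancel₀ hdet ?_
  rw [← Matrix.det_mul, mul_comm, ← Matrix.det_mul]
  simp [sub_mul, mul_sub, hmap]

theorem det_weightedFourCycle (p q : ℤ[X]) (l : ℤ) :
    (p • (1 : Matrix (Fin 4) (Fin 4) ℤ[X]) - q • (weightedFourCycle l).map C).det =
      p ^ 4 - (12 + C l ^ 2) * p ^ 2 * q ^ 2 + 4 * (2 - C l) ^ 2 * q ^ 4 := by
  simp [weightedFourCycle, Matrix.det_succ_row_zero, Fin.sum_univ_succ, Matrix.one_apply,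
    Fin.succAbove]
  ring

/-- The determinant factor in the Ihara–Bass formula for the Ihara zeta function of
the level-2 Schreier graph `Γ₂` of the BSV group with `d = 4`:
`det(I₁₆ − t·A₂ + 3t²·I₁₆) = (t−1)(t+1)(3t−1)(3t+1)(3t²+1)²(9t⁴−2t²+1)²·
(9t⁴−6t³+2t²−2t+1)²(9t⁴+6t³+2t²+2t+1)²`. -/
theorem bsv_level2_ihara_det :
    Matrix.det
      ((1 : Matrix (Fin 4 × Fin 4) (Fin 4 × Fin 4) (Polynomial ℤ))
        - (X : Polynomial ℤ) • (bsvAdj2.map C)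
        + (3 * X ^ 2 : Polynomial ℤ) •
            (1 : Matrix (Fin 4 × Fin 4) (Fin 4 × Fin 4) (Polynomial ℤ)))
      = (X - 1) * (X + 1) * (3 * X - 1) * (3 * X + 1) * (3 * X ^ 2 + 1) ^ 2
        * (9 * X ^ 4 - 2 * X ^ 2 + 1) ^ 2
        * (9 * X ^ 4 - 6 * X ^ 3 + 2 * X ^ 2 - 2 * X + 1) ^ 2
        * (9 * X ^ 4 + 6 * X ^ 3 + 2 * X ^ 2 + 2 * X + 1) ^ 2 := by
  have hdet : ((1 : Matrix (Fin 4) (Fin 4) ℤ) ⊗ₖ fourCycleEigenbasis).det ≠ 0 := by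
    simp [Matrix.det_kronecker, det_fourCycleEigenbasis_ne_zero]
  have hblock (p q : ℤ[X]) (B : Fin 4 → Matrix (Fin 4) (Fin 4) ℤ) :
      p • (1 : Matrix (Fin 4 × Fin 4) (Fin 4 × Fin 4) ℤ[X]) - q • (Matrix.blockDiagonal B).map C =
        Matrix.blockDiagonal fun i => p • 1 - q • (B i).map C := by
    rw [Matrix.blockDiagonal_map _ _ C_0, ← Matrix.blockDiagonal_one, ← Matrix.blockDiagonal_smul,
      ← Matrix.blockDiagonal_smul, ← Matrix.blockDiagonal_sub]
    rfl
  rw [show (1 : Matrix (Fin 4 × Fin 4) (Fin 4 × Fin 4) ℤ[X]) - (X : ℤ[X]) • bsvAdj2.map C +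
      (3 * X ^ 2 : ℤ[X]) • 1 = (1 + 3 * X ^ 2 : ℤ[X]) • 1 - (X : ℤ[X]) • bsvAdj2.map C by
    rw [add_smul, one_smul]; abel,
    det_smul_one_sub_smul_map_eq hdet bsvAdj2_mul_one_kronecker, hblock,
    Matrix.det_blockDiagonal]
  simp only [det_weightedFourCycle, Fin.prod_univ_four]
  simp [fourCycleEigenvalue]
  ring
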